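/- arXiv:2604.24423 — 2 statements merged into one kernel-verified Lean document; each statement's English description precedes it below -/
import Mathlib

section
/- The maximal correlation set equals the convex hull of rotated correlations with all orthogonal matrices: C_max = Conv{ A Q Bᵀ : Q ∈ O(3) }. -/
open Matrix Kronecker
open scoped ENNReal ComplexOrder

namespace BellCorr

/-- The three Pauli matrices. -/
noncomputable def pauli (k : Fin 3) : Matrix (Fin 2) (Fin 2) ℂ :=
  if k = 0 then !![0, 1; 1, 0]
  else if k = 1 then !![0, -Complex.I; Complex.I, 0]
  else !![1, 0; 0, -1]

/-- The observable `Â_i = ∑ k A i k • σ_k` associated with row `i` of `A`. -/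
noncomputable def obs {m : ℕ} (A : Matrix (Fin m) (Fin 3) ℝ) (i : Fin m) :
    Matrix (Fin 2) (Fin 2) ℂ :=
  ∑ k : Fin 3, (A i k : ℂ) • pauli k

/-- The correlation map `Φ_AB`, sending a 4×4 complex matrix to the real m×m matrix
with entries `Tr[ρ (Â_i ⊗ B̂_j)]`. -/
noncomputable def corr {m : ℕ} (A B : Matrix (Fin m) (Fin 3) ℝ)
    (ρ : Matrix (Fin 2 × Fin 2) (Fin 2 × Fin 2) ℂ) : Matrix (Fin m) (Fin m) ℝ :=
  Matrix.of fun i j => ((ρ * (obs A i ⊗ₖ obs B j)).trace).re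

/-- Separable states: convex hull of products of 2×2 PSD trace-one matrices. -/
noncomputable def Ssep : Set (Matrix (Fin 2 × Fin 2) (Fin 2 × Fin 2) ℂ) :=
  convexHull ℝ {ρ | ∃ ρA ρB : Matrix (Fin 2) (Fin 2) ℂ,
    ρA.PosSemidef ∧ ρA.trace = 1 ∧ ρB.PosSemidef ∧ ρB.trace = 1 ∧ ρ = ρA ⊗ₖ ρB}

/-- Quantum states: 4×4 PSD matrices of trace one. -/
def Sqm : Set (Matrix (Fin 2 × Fin 2) (Fin 2 × Fin 2) ℂ) :=
  {ρ | ρ.PosSemidef ∧ ρ.trace = 1}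

/-- Maximal-tensor-product states: self-adjoint trace-one matrices pairing
nonnegatively with every product of PSD matrices. -/
def Smax : Set (Matrix (Fin 2 × Fin 2) (Fin 2 × Fin 2) ℂ) :=
  {ρ | ρ.IsHermitian ∧ ρ.trace = 1 ∧
    ∀ P Q : Matrix (Fin 2) (Fin 2) ℂ, P.PosSemidef → Q.PosSemidef →
      0 ≤ ((ρ * (P ⊗ₖ Q)).trace).re}

noncomputable def Csep {m : ℕ} (A B : Matrix (Fin m) (Fin 3) ℝ) :
    Set (Matrix (Fin m) (Fin m) ℝ) := corr A B '' Ssep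

noncomputable def Cqm {m : ℕ} (A B : Matrix (Fin m) (Fin 3) ℝ) :
    Set (Matrix (Fin m) (Fin m) ℝ) := corr A B '' Sqm

noncomputable def Cmax {m : ℕ} (A B : Matrix (Fin m) (Fin 3) ℝ) :
    Set (Matrix (Fin m) (Fin m) ℝ) := corr A B '' Smax

/-- Support function `φ_K(Z) = sup_{C ∈ K} Tr[Zᵀ C]`. -/
noncomputable def suppFn {m : ℕ} (K : Set (Matrix (Fin m) (Fin m) ℝ))
    (Z : Matrix (Fin m) (Fin m) ℝ) : ℝ :=
  sSup ((fun C => (Zᵀ * C).trace) '' K)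

/-- Gauge function `γ_K(C) = inf {t > 0 : C/t ∈ K}`, with value `+∞` if no such `t` exists. -/
noncomputable def gaugeFn {m : ℕ} (K : Set (Matrix (Fin m) (Fin m) ℝ))
    (C : Matrix (Fin m) (Fin m) ℝ) : ℝ≥0∞ :=
  ⨅ (t : ℝ) (_ : 0 < t ∧ t⁻¹ • C ∈ K), ENNReal.ofReal t

/-- `XᵀX` is Hermitian for a real matrix `X`. -/
lemma isHermitian_tr_mul_self (X : Matrix (Fin 3) (Fin 3) ℝ) : (Xᵀ * X).IsHermitian := by
  simpa [Matrix.conjTranspose_eq_transpose_of_trivial] using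
    Matrix.isHermitian_conjTranspose_mul_self X

/-- The singular values of a real 3×3 matrix, in decreasing order:
`sval X 0 ≥ sval X 1 ≥ sval X 2 ≥ 0` are the square roots of the eigenvalues of `XᵀX`. -/
noncomputable def sval (X : Matrix (Fin 3) (Fin 3) ℝ) (i : Fin 3) : ℝ :=
  Real.sqrt ((isHermitian_tr_mul_self X).eigenvalues
    (Tuple.sort (isHermitian_tr_mul_self X).eigenvalues i.rev))

/-- Column space of a real matrix. -/
noncomputable def colSpace {m n : ℕ} (X : Matrix (Fin m) (Fin n) ℝ) :
    Submodule ℝ (Fin m → ℝ) := LinearMap.range X.mulVecLin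

/-- `Y` is the Moore–Penrose pseudoinverse of `X`. -/
def IsMP {m n : ℕ} (X : Matrix (Fin m) (Fin n) ℝ) (Y : Matrix (Fin n) (Fin m) ℝ) : Prop :=
  X * Y * X = X ∧ Y * X * Y = Y ∧ (X * Y)ᵀ = X * Y ∧ (Y * X)ᵀ = Y * X

/-! ### Convex hull of the orthogonal matrices -/

section Orthogonal

variable {n : Type*} [Fintype n]

/-- A vector with coordinates in `[-1, 1]` is a convex combination of sign vectors. -/
lemma mem_convexHull_signs {s : n → ℝ} (hs : ∀ i, |s i| ≤ 1) :
    s ∈ convexHull ℝ {d : n → ℝ | ∀ i, d i = -1 ∨ d i = 1} := by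
  have h : {d : n → ℝ | ∀ i, d i = -1 ∨ d i = 1} = Set.univ.pi fun _ => {-1, 1} := by
    ext d; simp [Set.mem_pi]
  rw [h, convexHull_pi]
  intro i _
  rw [convexHull_pair, segment_eq_Icc (by norm_num)]
  exact abs_le.mp (hs i)

variable [DecidableEq n]

/-- The columns of an orthonormal basis form an orthogonal matrix. -/
lemma transpose_mul_self_of_orthonormalBasis (b : OrthonormalBasis n ℝ (EuclideanSpace ℝ n)) :
    (of fun k i => b i k : Matrix n n ℝ)ᵀ * (of fun k i => b i k) = 1 := by
  ext i j
  have h := b.inner_eq_ite i j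
  rw [PiLp.inner_apply] at h
  simpa [Matrix.mul_apply, Matrix.one_apply, mul_comm] using h

/-- Singular value decomposition of a square real matrix. -/
lemma exists_orthogonal_diagonal (X : Matrix n n ℝ) :
    ∃ (U V : Matrix n n ℝ) (s : n → ℝ), Uᵀ * U = 1 ∧ Vᵀ * V = 1 ∧ X = U * diagonal s * Vᵀ := by
  have hH : (Xᵀ * X).IsHermitian := by
    simpa [conjTranspose_eq_transpose_of_trivial] using isHermitian_conjTranspose_mul_self X
  set b := hH.eigenvectorBasis with hb
  let w : n → EuclideanSpace ℝ n := fun i => WithLp.toLp 2 (X *ᵥ (b i).ofLp)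
  have hw : ∀ i j, inner ℝ (w i) (w j) = if i = j then hH.eigenvalues j else 0 := by
    intro i j
    have h1 : inner ℝ (w i) (w j) = (b i).ofLp ⬝ᵥ ((Xᵀ * X) *ᵥ (b j).ofLp) := by
      rw [← mulVec_mulVec, dotProduct_mulVec, vecMul_transpose]
      simp [w, EuclideanSpace.inner_eq_star_dotProduct, dotProduct_comm]
    have h2 : (b i).ofLp ⬝ᵥ (b j).ofLp = if i = j then 1 else 0 := by
      rw [← b.inner_eq_ite i j]
      simp [EuclideanSpace.inner_eq_star_dotProduct, dotProduct_comm]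
    rw [h1, hb, hH.mulVec_eigenvectorBasis, dotProduct_smul, ← hb, h2]
    simp
  have horth : Orthonormal ℝ (Set.domRestrict {i | w i ≠ 0} fun i => ‖w i‖⁻¹ • w i) := by
    refine ⟨fun ⟨i, hi⟩ => ?_, fun ⟨i, hi⟩ ⟨j, hj⟩ hij => ?_⟩
    · have : ‖w i‖ ≠ 0 := norm_ne_zero_iff.mpr hi
      simp [Set.domRestrict_apply, norm_smul, this]
    · have hne : i ≠ j := fun h => hij (Subtype.ext h)
      simp [Set.domRestrict_apply, inner_smul_left, inner_smul_right, hw, hne]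
  obtain ⟨c, hc⟩ := horth.exists_orthonormalBasis_extension_of_card_eq (by simp)
  have hwc : ∀ i, w i = ‖w i‖ • c i := by
    intro i
    by_cases hi : w i = 0
    · simp [hi]
    · have : ‖w i‖ ≠ 0 := norm_ne_zero_iff.mpr hi
      rw [hc i hi, smul_smul, mul_inv_cancel₀ this, one_smul]
  refine ⟨of fun k i => c i k, of fun k i => b i k, fun i => ‖w i‖,
    transpose_mul_self_of_orthonormalBasis c, transpose_mul_self_of_orthonormalBasis b, ?_⟩
  have hXV : X * (of fun k i => b i k) = (of fun k i => c i k) * diagonal fun i => ‖w i‖ := by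
    ext k i
    have h := congrArg (fun v : EuclideanSpace ℝ n => v k) (hwc i)
    rw [mul_diagonal]
    simpa [w, mulVec, dotProduct, Matrix.mul_apply, mul_comm] using h
  rw [← hXV, Matrix.mul_assoc, mul_eq_one_comm.mp (transpose_mul_self_of_orthonormalBasis b),
    Matrix.mul_one]

/-- A real matrix whose bilinear form is bounded by `1` on unit vectors is a convex combination of
orthogonal matrices. -/
lemma mem_convexHull_orthogonal {X : Matrix n n ℝ}
    (hX : ∀ a b : n → ℝ, a ⬝ᵥ a = 1 → b ⬝ᵥ b = 1 → |a ⬝ᵥ X *ᵥ b| ≤ 1) :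
    X ∈ convexHull ℝ {Q : Matrix n n ℝ | Qᵀ * Q = 1} := by
  obtain ⟨U, V, s, hU, hV, rfl⟩ := exists_orthogonal_diagonal X
  have hcol : ∀ {W : Matrix n n ℝ}, Wᵀ * W = 1 → ∀ i, W.col i ⬝ᵥ W.col i = 1 := by
    intro W hW i
    simpa [Matrix.mul_apply, dotProduct] using congrFun (congrFun hW i) i
  have hs : ∀ i, |s i| ≤ 1 := by
    intro i
    have hval : U.col i ⬝ᵥ (U * diagonal s * Vᵀ) *ᵥ V.col i = s i := by
      rw [← mulVec_single_one U i, ← mulVec_single_one V i, mulVec_mulVec, Matrix.mul_assoc, hV,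
        Matrix.mul_one, ← mulVec_mulVec, dotProduct_mulVec, ← mulVec_transpose, mulVec_mulVec, hU]
      simp
    simpa [hval] using hX _ _ (hcol hU i) (hcol hV i)
  let L : (n → ℝ) →ₗ[ℝ] Matrix n n ℝ :=
    { toFun := fun d => U * diagonal d * Vᵀ
      map_add' := fun d e => by rw [← Matrix.add_mul, ← Matrix.mul_add, diagonal_add]; rfl
      map_smul' := fun r d => by simp [diagonal_smul] }
  have hmem : L s ∈ convexHull ℝ (L '' {d : n → ℝ | ∀ i, d i = -1 ∨ d i = 1}) := by
    rw [← L.image_convexHull]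
    exact Set.mem_image_of_mem _ (mem_convexHull_signs hs)
  refine convexHull_mono ?_ hmem
  rintro _ ⟨d, hd, rfl⟩
  have hdd : diagonal d * diagonal d = (1 : Matrix n n ℝ) := by
    rw [diagonal_mul_diagonal, ← diagonal_one]
    congr 1
    ext i
    rcases hd i with h | h <;> simp [h]
  calc (U * diagonal d * Vᵀ)ᵀ * (U * diagonal d * Vᵀ)
      = V * (diagonal d * (Uᵀ * U) * diagonal d) * Vᵀ := by
        simp [Matrix.transpose_mul, Matrix.mul_assoc]
    _ = 1 := by rw [hU, Matrix.mul_one, hdd, Matrix.mul_one, mul_eq_one_comm.mp hV]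

/-- The bilinear form of an orthogonal matrix satisfies the Cauchy–Schwarz bound. -/
lemma sq_dotProduct_mulVec_le {Q : Matrix n n ℝ} (hQ : Qᵀ * Q = 1) (p r : n → ℝ) :
    (p ⬝ᵥ Q *ᵥ r) ^ 2 ≤ (p ⬝ᵥ p) * (r ⬝ᵥ r) := by
  have h : Q *ᵥ r ⬝ᵥ Q *ᵥ r = r ⬝ᵥ r := by
    rw [dotProduct_mulVec, ← mulVec_transpose, mulVec_mulVec, hQ, one_mulVec]
  rw [← h]
  simpa [dotProduct, sq] using Finset.sum_mul_sq_le_sq_mul_sq Finset.univ p (Q *ᵥ r)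

end Orthogonal

/-! ### Pauli matrices -/

lemma isHermitian_pauli (k : Fin 3) : (pauli k).IsHermitian := by
  ext i j
  fin_cases k <;> fin_cases i <;> fin_cases j <;> simp [pauli]

lemma trace_pauli (k : Fin 3) : (pauli k).trace = 0 := by
  fin_cases k <;> simp [pauli, trace_fin_two]

lemma trace_pauli_mul_pauli (k l : Fin 3) :
    (pauli k * pauli l).trace = if k = l then 2 else 0 := by
  fin_cases k <;> fin_cases l <;> simp [pauli, trace_fin_two] <;> norm_num

/-- The observable `∑ k, a k • σ_k` of a real vector `a`. -/
noncomputable def pauliVec (a : Fin 3 → ℝ) : Matrix (Fin 2) (Fin 2) ℂ :=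
  ∑ k, (a k : ℂ) • pauli k

lemma pauliVec_neg (a : Fin 3 → ℝ) : pauliVec (-a) = -pauliVec a := by
  simp [pauliVec]

lemma isHermitian_pauliVec (a : Fin 3 → ℝ) : (pauliVec a).IsHermitian := by
  simp [pauliVec, IsHermitian, conjTranspose_sum, conjTranspose_smul, (isHermitian_pauli _).eq]

lemma pauliVec_mul_self (a : Fin 3 → ℝ) : pauliVec a * pauliVec a = ((a ⬝ᵥ a : ℝ) : ℂ) • 1 := by
  ext i j
  fin_cases i <;> fin_cases j <;>
    simp [pauliVec, pauli, Fin.sum_univ_three, Matrix.mul_apply, dotProduct] <;>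
    ring_nf <;> simp

lemma posSemidef_one_add_pauliVec {a : Fin 3 → ℝ} (ha : a ⬝ᵥ a = 1) :
    (1 + pauliVec a).PosSemidef := by
  have h : 1 + pauliVec a = (1 / 2 : ℝ) • ((1 + pauliVec a)ᴴ * (1 + pauliVec a)) := by
    rw [conjTranspose_add, conjTranspose_one, (isHermitian_pauliVec a).eq, Matrix.add_mul,
      Matrix.mul_add, Matrix.mul_add, pauliVec_mul_self, ha]
    simp only [Matrix.one_mul, Matrix.mul_one, Complex.ofReal_one, one_smul]
    module
  rw [h]
  exact (posSemidef_conjTranspose_mul_self _).smul (by norm_num)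

/-- The Bloch coordinates of a Hermitian matrix are real. -/
lemma trace_pauli_mul_eq_ofReal {P : Matrix (Fin 2) (Fin 2) ℂ} (hP : P.IsHermitian) (k : Fin 3) :
    (pauli k * P).trace = ((pauli k * P).trace.re : ℂ) := by
  refine (Complex.conj_eq_iff_re.mp ?_).symm
  rw [← Complex.star_def, ← trace_conjTranspose, conjTranspose_mul, hP.eq,
    (isHermitian_pauli k).eq, trace_mul_comm]

/-- The Bloch vector of a positive semidefinite matrix lies in the forward cone. -/
lemma bloch_dotProduct_le {P : Matrix (Fin 2) (Fin 2) ℂ} (hP : P.PosSemidef) :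
    (fun k => (pauli k * P).trace.re) ⬝ᵥ (fun k => (pauli k * P).trace.re) ≤ P.trace.re ^ 2 := by
  have hdet := (Complex.le_def.mp hP.det_nonneg).1
  have h0 : (P 0 0).im = 0 := Complex.conj_eq_iff_im.mp (hP.1.apply 0 0)
  have h1 : (P 1 1).im = 0 := Complex.conj_eq_iff_im.mp (hP.1.apply 1 1)
  have h10 : P 1 0 = star (P 0 1) := (hP.1.apply 1 0).symm
  simp [det_fin_two, h0, h1, h10] at hdet
  simp [dotProduct, Fin.sum_univ_three, pauli, trace_fin_two, vecMul, h10]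
  nlinarith

/-! ### States and their correlation matrices -/

/-- The correlation matrix of `ρ` in the Pauli basis. -/
noncomputable def pauliCorr (ρ : Matrix (Fin 2 × Fin 2) (Fin 2 × Fin 2) ℂ) :
    Matrix (Fin 3) (Fin 3) ℝ :=
  of fun k l => ((ρ * (pauli k ⊗ₖ pauli l)).trace).re

lemma re_trace_mul_pauliVec_kronecker (ρ : Matrix (Fin 2 × Fin 2) (Fin 2 × Fin 2) ℂ)
    (a b : Fin 3 → ℝ) :
    ((ρ * (pauliVec a ⊗ₖ pauliVec b)).trace).re = a ⬝ᵥ pauliCorr ρ *ᵥ b := by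
  have h : pauliVec a ⊗ₖ pauliVec b =
      ∑ k, ∑ l, ((a k * b l : ℝ) : ℂ) • (pauli k ⊗ₖ pauli l) := by
    ext ⟨i, j⟩ ⟨i', j'⟩
    simp only [pauliVec, kroneckerMap_apply, Matrix.sum_apply, Matrix.smul_apply, smul_eq_mul,
      Finset.sum_mul_sum]
    push_cast
    refine Finset.sum_congr rfl fun k _ => Finset.sum_congr rfl fun l _ => by ring
  rw [h]
  simp only [trace_sum, Matrix.mul_smul, trace_smul, smul_eq_mul, Complex.re_sum,
    Complex.re_ofReal_mul, dotProduct, mulVec, pauliCorr, of_apply, Finset.mul_sum]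
  refine Finset.sum_congr rfl fun k _ => Finset.sum_congr rfl fun l _ => by ring

lemma corr_eq_mul {m : ℕ} (A B : Matrix (Fin m) (Fin 3) ℝ)
    (ρ : Matrix (Fin 2 × Fin 2) (Fin 2 × Fin 2) ℂ) : corr A B ρ = A * pauliCorr ρ * Bᵀ := by
  ext i j
  have h := re_trace_mul_pauliVec_kronecker ρ (A i) (B j)
  rw [dotProduct_mulVec] at h
  exact h

lemma neg_one_le_of_mem_Smax {ρ : Matrix (Fin 2 × Fin 2) (Fin 2 × Fin 2) ℂ} (hρ : ρ ∈ Smax)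
    {a b : Fin 3 → ℝ} (ha : a ⬝ᵥ a = 1) (hb : b ⬝ᵥ b = 1) : -1 ≤ a ⬝ᵥ pauliCorr ρ *ᵥ b := by
  obtain ⟨-, htr, hpos⟩ := hρ
  have h₁ := hpos _ _ (posSemidef_one_add_pauliVec ha) (posSemidef_one_add_pauliVec hb)
  have h₂ := hpos _ _ (posSemidef_one_add_pauliVec (a := -a) (by simpa using ha))
    (posSemidef_one_add_pauliVec (a := -b) (by simpa using hb))
  have hsum : (1 + pauliVec a) ⊗ₖ (1 + pauliVec b) + (1 + pauliVec (-a)) ⊗ₖ (1 + pauliVec (-b)) =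
      (2 : ℝ) • (1 + pauliVec a ⊗ₖ pauliVec b) := by
    rw [pauliVec_neg, pauliVec_neg, ← one_kronecker_one (α := ℂ)]
    ext ⟨i, j⟩ ⟨i', j'⟩
    simp only [kroneckerMap_apply, Matrix.add_apply, Matrix.smul_apply, Matrix.neg_apply,
      Complex.real_smul]
    push_cast
    ring
  have h := add_nonneg h₁ h₂
  rw [← Complex.add_re, ← trace_add, ← Matrix.mul_add, hsum, Matrix.mul_smul, trace_smul,
    Complex.smul_re, Matrix.mul_add, trace_add, Complex.add_re, Matrix.mul_one, htr,
    re_trace_mul_pauliVec_kronecker, smul_eq_mul, Complex.one_re] at h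
  linarith

lemma abs_le_one_of_mem_Smax {ρ : Matrix (Fin 2 × Fin 2) (Fin 2 × Fin 2) ℂ} (hρ : ρ ∈ Smax)
    {a b : Fin 3 → ℝ} (ha : a ⬝ᵥ a = 1) (hb : b ⬝ᵥ b = 1) : |a ⬝ᵥ pauliCorr ρ *ᵥ b| ≤ 1 := by
  have h := neg_one_le_of_mem_Smax hρ (a := -a) (by simpa using ha) hb
  rw [neg_dotProduct] at h
  exact abs_le.mpr ⟨neg_one_le_of_mem_Smax hρ ha hb, by linarith⟩

/-- The self-adjoint matrix with correlation matrix `Q` and maximally mixed marginals. -/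
noncomputable def corrState (Q : Matrix (Fin 3) (Fin 3) ℝ) :
    Matrix (Fin 2 × Fin 2) (Fin 2 × Fin 2) ℂ :=
  (1 / 4 : ℂ) • (1 + ∑ k, ∑ l, (Q k l : ℂ) • (pauli k ⊗ₖ pauli l))

lemma trace_corrState_mul_kronecker (Q : Matrix (Fin 3) (Fin 3) ℝ)
    (P R : Matrix (Fin 2) (Fin 2) ℂ) :
    (corrState Q * (P ⊗ₖ R)).trace = 1 / 4 * (P.trace * R.trace +
      ∑ k, ∑ l, (Q k l : ℂ) * ((pauli k * P).trace * (pauli l * R).trace)) := by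
  simp only [corrState, Matrix.smul_mul, Matrix.add_mul, Matrix.sum_mul, ← mul_kronecker_mul,
    trace_smul, trace_add, trace_sum, trace_kronecker, Matrix.one_mul, smul_eq_mul]

lemma pauliCorr_corrState (Q : Matrix (Fin 3) (Fin 3) ℝ) : pauliCorr (corrState Q) = Q := by
  ext k l
  simp [pauliCorr, trace_corrState_mul_kronecker, trace_pauli, trace_pauli_mul_pauli]
  ring

lemma corrState_mem_Smax {Q : Matrix (Fin 3) (Fin 3) ℝ} (hQ : Qᵀ * Q = 1) :
    corrState Q ∈ Smax := by
  refine ⟨?_, ?_, fun P R hP hR => ?_⟩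
  · simp [corrState, IsHermitian, conjTranspose_sum, conjTranspose_smul, conjTranspose_kronecker,
      (isHermitian_pauli _).eq]
  · have h := trace_corrState_mul_kronecker Q 1 1
    rw [one_kronecker_one, Matrix.mul_one] at h
    rw [h]
    simp [trace_pauli]
    norm_num
  · set p : Fin 3 → ℝ := fun k => (pauli k * P).trace.re with hp
    set r : Fin 3 → ℝ := fun k => (pauli k * R).trace.re with hr
    have hP0 := Complex.le_def.mp hP.trace_nonneg
    have hR0 := Complex.le_def.mp hR.trace_nonneg
    have hval : ((corrState Q * (P ⊗ₖ R)).trace).re =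
        1 / 4 * (P.trace.re * R.trace.re + p ⬝ᵥ Q *ᵥ r) := by
      have hsum : ∑ k, ∑ l, (Q k l : ℂ) * ((pauli k * P).trace * (pauli l * R).trace) =
          ((p ⬝ᵥ Q *ᵥ r : ℝ) : ℂ) := by
        simp only [dotProduct, mulVec, Finset.mul_sum]
        push_cast
        refine Finset.sum_congr rfl fun k _ => Finset.sum_congr rfl fun l _ => ?_
        rw [trace_pauli_mul_eq_ofReal hP.1, trace_pauli_mul_eq_ofReal hR.1]
        ring
      rw [trace_corrState_mul_kronecker, hsum,
        show (1 / 4 : ℂ) = ((1 / 4 : ℝ) : ℂ) by norm_num, Complex.re_ofReal_mul, Complex.add_re,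
        Complex.ofReal_re, Complex.mul_re, ← hP0.2]
      simp
    have hbound : |p ⬝ᵥ Q *ᵥ r| ≤ P.trace.re * R.trace.re := by
      refine abs_le_of_sq_le_sq ?_ (mul_nonneg hP0.1 hR0.1)
      rw [mul_pow]
      exact (sq_dotProduct_mulVec_le hQ p r).trans
        (mul_le_mul (bloch_dotProduct_le hP) (bloch_dotProduct_le hR)
          (Finset.sum_nonneg fun i _ => mul_self_nonneg _) (sq_nonneg _))
    rw [hval]
    linarith [(abs_le.mp hbound).1]

lemma convex_Smax : Convex ℝ Smax := by
  rintro ρ ⟨h₁, h₂, h₃⟩ τ ⟨k₁, k₂, k₃⟩ s t hs ht hst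
  refine ⟨?_, ?_, fun P R hP hR => ?_⟩
  · simp [IsHermitian, conjTranspose_smul, h₁.eq, k₁.eq]
  · rw [trace_add, trace_smul, trace_smul, h₂, k₂, ← add_smul, hst, one_smul]
  · rw [Matrix.add_mul, Matrix.smul_mul, Matrix.smul_mul, trace_add, trace_smul, trace_smul,
      Complex.add_re, Complex.smul_re, Complex.smul_re]
    exact add_nonneg (mul_nonneg hs (h₃ P R hP hR)) (mul_nonneg ht (k₃ P R hP hR))

lemma isLinearMap_corr {m : ℕ} (A B : Matrix (Fin m) (Fin 3) ℝ) : IsLinearMap ℝ (corr A B) where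
  map_add ρ τ := by ext; simp [corr, Matrix.add_mul]
  map_smul c ρ := by ext; simp [corr]

/-- The linear map `Q ↦ A Q Bᵀ`. -/
def sandwich {m : ℕ} (A B : Matrix (Fin m) (Fin 3) ℝ) :
    Matrix (Fin 3) (Fin 3) ℝ →ₗ[ℝ] Matrix (Fin m) (Fin m) ℝ where
  toFun Q := A * Q * Bᵀ
  map_add' Q R := by rw [Matrix.mul_add, Matrix.add_mul]
  map_smul' c Q := by simp

/-- Convex hull characterization of the maximal correlation set. -/
theorem stmt11 {m : ℕ} (hm : 1 ≤ m) (A B : Matrix (Fin m) (Fin 3) ℝ)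
    (hA : ∀ i, ∑ k, A i k ^ 2 = 1) (hB : ∀ i, ∑ k, B i k ^ 2 = 1) :
    Cmax A B = convexHull ℝ {C : Matrix (Fin m) (Fin m) ℝ |
      ∃ Q : Matrix (Fin 3) (Fin 3) ℝ, Qᵀ * Q = 1 ∧ C = A * Q * Bᵀ} := by
  apply Set.Subset.antisymm
  · rintro _ ⟨ρ, hρ, rfl⟩
    have hmem : sandwich A B (pauliCorr ρ) ∈ convexHull ℝ (sandwich A B '' {Q | Qᵀ * Q = 1}) := by
      rw [← (sandwich A B).image_convexHull]
      exact Set.mem_image_of_mem _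
        (mem_convexHull_orthogonal fun a b ha hb => abs_le_one_of_mem_Smax hρ ha hb)
    rw [corr_eq_mul]
    refine convexHull_mono ?_ hmem
    rintro _ ⟨Q, hQ, rfl⟩
    exact ⟨Q, hQ, rfl⟩
  · refine convexHull_min ?_ (convex_Smax.is_linear_image (isLinearMap_corr A B))
    rintro _ ⟨Q, hQ, rfl⟩
    exact ⟨corrState Q, corrState_mem_Smax hQ, by rw [corr_eq_mul, pauliCorr_corrState]⟩

end BellCorr
end

section
/- Let r := min{rank A, rank B}. The supremum over all nonzero real m×m matrices Z with φ_{C_sep}(Z) > 0 of the ratio φ_{C_qm}(Z)/φ_{C_sep}(Z) is attained and equals 3 if r = 3, equals 2 if r = 2, and equals 1 if r = 1. -/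
open Matrix Kronecker
open scoped ENNReal ComplexOrder

namespace BellCorr

/-- The observable `a · σ` of a real vector `a`. -/
noncomputable def vecObs (a : Fin 3 → ℝ) : Matrix (Fin 2) (Fin 2) ℂ :=
  ∑ k : Fin 3, (a k : ℂ) • pauli k

lemma vecObs_eq (a : Fin 3 → ℝ) :
    vecObs a = !![(a 2 : ℂ), a 0 - a 1 * Complex.I; a 0 + a 1 * Complex.I, -(a 2 : ℂ)] := by
  ext i j
  fin_cases i <;> fin_cases j <;> (simp [vecObs, Fin.sum_univ_three, pauli]; try ring)

lemma vecObs_isHermitian (a : Fin 3 → ℝ) : (vecObs a).IsHermitian := by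
  rw [vecObs_eq]
  ext i j
  fin_cases i <;> fin_cases j <;> (simp [Complex.conj_ofReal]; try ring)

lemma trace_vecObs (a : Fin 3 → ℝ) : (vecObs a).trace = 0 := by
  simp [vecObs_eq, Matrix.trace_fin_two]

lemma trace_vecObs_mul (a b : Fin 3 → ℝ) :
    (vecObs a * vecObs b).trace = 2 * ((a ⬝ᵥ b : ℝ) : ℂ) := by
  simp only [vecObs_eq, Matrix.trace_fin_two, dotProduct, Fin.sum_univ_three]
  simp [Matrix.mul_apply]
  linear_combination (-2 * (a 1 : ℂ) * b 1) * Complex.I_sq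

lemma vecObs_mul_self {a : Fin 3 → ℝ} (ha : a ⬝ᵥ a = 1) : vecObs a * vecObs a = 1 := by
  have h : (a 0 : ℂ) * a 0 + a 1 * a 1 + a 2 * a 2 = 1 := by
    rw [dotProduct, Fin.sum_univ_three] at ha; exact_mod_cast ha
  rw [vecObs_eq]
  ext i j
  fin_cases i <;> fin_cases j <;> simp [Matrix.mul_apply] <;>
    first
    | linear_combination h - (a 1 : ℂ) ^ 2 * Complex.I_sq
    | ring

lemma vecObs_anticomm {a b : Fin 3 → ℝ} (h : a ⬝ᵥ b = 0) :
    vecObs b * vecObs a = -(vecObs a * vecObs b) := by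
  have h : (a 0 : ℂ) * b 0 + a 1 * b 1 + a 2 * b 2 = 0 := by
    rw [dotProduct, Fin.sum_univ_three] at h; exact_mod_cast h
  rw [vecObs_eq, vecObs_eq]
  ext i j
  fin_cases i <;> fin_cases j <;> simp [Matrix.mul_apply] <;>
    first
    | linear_combination 2 * h - 2 * (a 1 : ℂ) * b 1 * Complex.I_sq
    | ring

/-- The 3×3 correlation matrix of `ρ`. -/
noncomputable def corrMat (ρ : Matrix (Fin 2 × Fin 2) (Fin 2 × Fin 2) ℂ) :
    Matrix (Fin 3) (Fin 3) ℝ :=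
  Matrix.of fun k l => ((ρ * (pauli k ⊗ₖ pauli l)).trace).re

lemma dotProduct_corrMat_mulVec (ρ : Matrix (Fin 2 × Fin 2) (Fin 2 × Fin 2) ℂ)
    (a b : Fin 3 → ℝ) :
    a ⬝ᵥ (corrMat ρ *ᵥ b) = ((ρ * (vecObs a ⊗ₖ vecObs b)).trace).re := by
  simp only [vecObs, corrMat, dotProduct, mulVec, Fin.sum_univ_three, Matrix.of_apply,
    Matrix.add_kronecker, Matrix.kronecker_add, Matrix.smul_kronecker, Matrix.kronecker_smul,
    Matrix.mul_add, Matrix.mul_smul, Matrix.trace_add, Matrix.trace_smul, Complex.add_re,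
    smul_eq_mul, Complex.re_ofReal_mul]
  ring

lemma corr_eq {m : ℕ} (A B : Matrix (Fin m) (Fin 3) ℝ)
    (ρ : Matrix (Fin 2 × Fin 2) (Fin 2 × Fin 2) ℂ) :
    corr A B ρ = A * corrMat ρ * Bᵀ := by
  ext i j
  have := dotProduct_corrMat_mulVec ρ (A i) (B j)
  rw [corr, Matrix.of_apply, obs, obs]
  rw [vecObs, vecObs] at this
  rw [← this, Matrix.mul_assoc]
  simp [Matrix.mul_apply, dotProduct, mulVec]

lemma trace_transpose_mul_corr {m : ℕ} (A B : Matrix (Fin m) (Fin 3) ℝ)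
    (Z : Matrix (Fin m) (Fin m) ℝ) (ρ : Matrix (Fin 2 × Fin 2) (Fin 2 × Fin 2) ℂ) :
    (Zᵀ * corr A B ρ).trace = ((Aᵀ * Z * B)ᵀ * corrMat ρ).trace := by
  rw [corr_eq, ← Matrix.mul_assoc, Matrix.trace_mul_comm]
  simp [Matrix.mul_assoc]

lemma trace_vecMulVec_transpose_mul (a b : Fin 3 → ℝ) (T : Matrix (Fin 3) (Fin 3) ℝ) :
    ((vecMulVec a b)ᵀ * T).trace = a ⬝ᵥ (T *ᵥ b) := by
  simp [Matrix.trace, Matrix.mul_apply, vecMulVec_apply, dotProduct, mulVec, Fin.sum_univ_three]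
  ring

lemma trace_transpose_mul_vecMulVec (X : Matrix (Fin 3) (Fin 3) ℝ) (a b : Fin 3 → ℝ) :
    (Xᵀ * vecMulVec a b).trace = a ⬝ᵥ (X *ᵥ b) := by
  rw [← trace_vecMulVec_transpose_mul, ← Matrix.trace_transpose, Matrix.transpose_mul,
    Matrix.transpose_transpose]

lemma posSemidef_of_isHermitian_of_mul_self {n : Type*} [Fintype n] {P : Matrix n n ℂ}
    (h : P.IsHermitian) (h2 : P * P = P) : P.PosSemidef := by
  have := Matrix.posSemidef_conjTranspose_mul_self P
  rwa [h.eq, h2] at this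

lemma vecObs_kronecker_mul_self {a b : Fin 3 → ℝ} (ha : a ⬝ᵥ a = 1) (hb : b ⬝ᵥ b = 1) :
    (vecObs a ⊗ₖ vecObs b) * (vecObs a ⊗ₖ vecObs b) = 1 := by
  rw [← Matrix.mul_kronecker_mul, vecObs_mul_self ha, vecObs_mul_self hb, Matrix.one_kronecker_one]

lemma vecObs_kronecker_isHermitian (a b : Fin 3 → ℝ) :
    (vecObs a ⊗ₖ vecObs b).IsHermitian := by
  rw [Matrix.IsHermitian, Matrix.conjTranspose_kronecker, (vecObs_isHermitian a).eq,
    (vecObs_isHermitian b).eq]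

lemma half_one_add_mul_self {n : Type*} [Fintype n] [DecidableEq n] {U : Matrix n n ℂ}
    (h : U * U = 1) : ((1 / 2 : ℂ) • (1 + U)) * ((1 / 2 : ℂ) • (1 + U)) = (1 / 2 : ℂ) • (1 + U) := by
  simp only [Matrix.smul_mul, Matrix.mul_smul, Matrix.add_mul, Matrix.mul_add, h,
    Matrix.one_mul, Matrix.mul_one]
  module

lemma half_one_add_isHermitian {n : Type*} [DecidableEq n] {U : Matrix n n ℂ}
    (h : U.IsHermitian) : ((1 / 2 : ℂ) • (1 + U)).IsHermitian := by
  simp [Matrix.IsHermitian, Matrix.conjTranspose_smul, h.eq]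

lemma half_one_add_posSemidef {n : Type*} [Fintype n] [DecidableEq n] {U : Matrix n n ℂ}
    (h : U.IsHermitian) (h2 : U * U = 1) : ((1 / 2 : ℂ) • (1 + U)).PosSemidef :=
  posSemidef_of_isHermitian_of_mul_self (half_one_add_isHermitian h) (half_one_add_mul_self h2)

lemma dotProduct_corrMat_mulVec_le_one {ρ : Matrix (Fin 2 × Fin 2) (Fin 2 × Fin 2) ℂ}
    (hρ : ρ ∈ Sqm) {a b : Fin 3 → ℝ} (ha : a ⬝ᵥ a = 1) (hb : b ⬝ᵥ b = 1) :
    a ⬝ᵥ (corrMat ρ *ᵥ b) ≤ 1 := by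
  rw [dotProduct_corrMat_mulVec]
  set U := vecObs a ⊗ₖ vecObs b with hU
  have h1 : (-U).IsHermitian := (vecObs_kronecker_isHermitian a b).neg
  have h2 : (-U) * (-U) = 1 := by rw [neg_mul_neg, vecObs_kronecker_mul_self ha hb]
  set P := (1 / 2 : ℂ) • (1 + -U) with hP
  have h3 : (P * ρ * Pᴴ).PosSemidef := hρ.1.mul_mul_conjTranspose_same P
  have h4 := h3.trace_nonneg
  rw [(half_one_add_isHermitian h1).eq, Matrix.mul_assoc, Matrix.trace_mul_comm, Matrix.mul_assoc,
    half_one_add_mul_self h2, Matrix.mul_smul, Matrix.trace_smul, Matrix.mul_add, Matrix.mul_neg,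
    Matrix.mul_one, Matrix.trace_add, Matrix.trace_neg, hρ.2] at h4
  have h5 := (Complex.le_def.1 h4).1
  simp at h5
  linarith

/-- The pure qubit state with Bloch vector `a`. -/
noncomputable def blochState (a : Fin 3 → ℝ) : Matrix (Fin 2) (Fin 2) ℂ :=
  (1 / 2 : ℂ) • (1 + vecObs a)

lemma blochState_posSemidef {a : Fin 3 → ℝ} (ha : a ⬝ᵥ a = 1) : (blochState a).PosSemidef :=
  half_one_add_posSemidef (vecObs_isHermitian a) (vecObs_mul_self ha)

lemma trace_blochState (a : Fin 3 → ℝ) : (blochState a).trace = 1 := by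
  simp [blochState, Matrix.trace_add, trace_vecObs]

lemma trace_blochState_mul (a b : Fin 3 → ℝ) :
    (blochState a * vecObs b).trace = ((a ⬝ᵥ b : ℝ) : ℂ) := by
  simp [blochState, Matrix.trace_add, trace_vecObs, Matrix.add_mul, trace_vecObs_mul]

lemma corrMat_blochState (a b : Fin 3 → ℝ) :
    corrMat (blochState a ⊗ₖ blochState b) = vecMulVec a b := by
  ext k l
  have := dotProduct_corrMat_mulVec (blochState a ⊗ₖ blochState b) (Pi.single k 1) (Pi.single l 1)
  rw [← Matrix.mul_kronecker_mul, Matrix.trace_kronecker, trace_blochState_mul,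
    trace_blochState_mul] at this
  simpa [vecMulVec_apply, Matrix.mulVec_single_one] using this

/-- A qubit state is determined by a Bloch vector in the unit ball. -/
lemma exists_eq_blochState {ρ : Matrix (Fin 2) (Fin 2) ℂ} (h : ρ.PosSemidef) (ht : ρ.trace = 1) :
    ∃ a : Fin 3 → ℝ, a ⬝ᵥ a ≤ 1 ∧ ρ = blochState a := by
  have h00 := h.1.apply 0 0
  have h01 := h.1.apply 0 1
  have h11 := h.1.apply 1 1
  have hd := h.det_nonneg
  rw [Matrix.trace_fin_two] at ht
  rw [Matrix.det_fin_two] at hd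
  have hd := (Complex.le_def.1 hd).1
  simp only [Complex.ext_iff, RCLike.star_def, Complex.conj_re, Complex.conj_im, Complex.add_re,
    Complex.add_im, Complex.one_re, Complex.one_im] at h00 h01 h11 ht
  simp only [Complex.zero_re, Complex.sub_re, Complex.mul_re] at hd
  refine ⟨![2 * (ρ 1 0).re, 2 * (ρ 1 0).im, (ρ 0 0).re - (ρ 1 1).re], ?_, ?_⟩
  · simp only [dotProduct, Fin.sum_univ_three, Matrix.cons_val]
    have e0 : (ρ 0 0).im = 0 := by linarith
    have e1 : (ρ 1 1).im = 0 := by linarith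
    rw [e0, e1, ← h01.1, ← h01.2] at hd
    have : (ρ 0 0).re = 1 - (ρ 1 1).re := by linarith
    rw [this] at hd ⊢
    nlinarith
  · rw [blochState, vecObs_eq]
    ext i j
    fin_cases i <;> fin_cases j <;> simp [Complex.ext_iff] <;> constructor <;> linarith

/-- An orthonormal basis of the row space of `A`. -/
lemma exists_orthonormal_rowSpace {m : ℕ} (A : Matrix (Fin m) (Fin 3) ℝ) :
    ∃ e : Fin A.rank → Fin 3 → ℝ, (∀ i j, e i ⬝ᵥ e j = if i = j then 1 else 0) ∧
      (∀ i, ∃ u, Aᵀ *ᵥ u = e i) ∧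
      ∀ u, Aᵀ *ᵥ u = ∑ i, (e i ⬝ᵥ (Aᵀ *ᵥ u)) • e i := by
  set L := (WithLp.linearEquiv 2 ℝ (Fin 3 → ℝ)).symm with hL
  set S : Submodule ℝ (EuclideanSpace ℝ (Fin 3)) :=
    (LinearMap.range Aᵀ.mulVecLin).map L.toLinearMap with hS
  have hr : Module.finrank ℝ S = A.rank := by
    rw [hS, LinearEquiv.finrank_map_eq, ← Matrix.rank_transpose A]
    rfl
  let b := (stdOrthonormalBasis ℝ S).reindex (finCongr hr)
  refine ⟨fun i => (b i : EuclideanSpace ℝ (Fin 3)).ofLp, ?_, ?_, ?_⟩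
  · intro i j
    have := orthonormal_iff_ite.1 b.orthonormal i j
    rw [← this, Submodule.coe_inner, EuclideanSpace.inner_eq_star_dotProduct, dotProduct_comm]
    rfl
  · intro i
    obtain ⟨x, ⟨u, hu⟩, hx⟩ := (b i).2
    refine ⟨u, ?_⟩
    change _ = (b i : EuclideanSpace ℝ (Fin 3)).ofLp
    rw [← hx, ← hu]
    rfl
  · intro u
    have hu : L (Aᵀ *ᵥ u) ∈ S := ⟨_, ⟨u, rfl⟩, rfl⟩
    have := congrArg (fun x : S => (x : EuclideanSpace ℝ (Fin 3)).ofLp) (b.sum_repr' ⟨_, hu⟩)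
    simp only [Submodule.coe_sum, Submodule.coe_smul, WithLp.ofLp_sum, WithLp.ofLp_smul] at this
    rw [show Aᵀ *ᵥ u = (L (Aᵀ *ᵥ u)).ofLp from rfl, ← this]
    refine Finset.sum_congr rfl fun i _ => ?_
    rw [this, Submodule.coe_inner, EuclideanSpace.inner_eq_star_dotProduct, dotProduct_comm]
    rfl

lemma vecMul_dotProduct_vecMul_le {X T : Matrix (Fin 3) (Fin 3) ℝ} {c : ℝ}
    (hX : ∀ a b : Fin 3 → ℝ, a ⬝ᵥ a = 1 → b ⬝ᵥ b = 1 → a ⬝ᵥ (X *ᵥ b) ≤ c)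
    (hT : ∀ a b : Fin 3 → ℝ, a ⬝ᵥ a = 1 → b ⬝ᵥ b = 1 → a ⬝ᵥ (T *ᵥ b) ≤ 1)
    {e : Fin 3 → ℝ} (he : e ⬝ᵥ e = 1) : (e ᵥ* X) ⬝ᵥ (e ᵥ* T) ≤ c := by
  set y := e ᵥ* X with hy
  by_cases h0 : y = 0
  · have h := hX e e he he
    rw [dotProduct_mulVec, ← hy, h0, zero_dotProduct] at h
    rwa [h0, zero_dotProduct]
  have hpos : 0 < y ⬝ᵥ y :=
    lt_of_le_of_ne (Finset.sum_nonneg fun i _ => mul_self_nonneg (y i))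
      (Ne.symm (mt dotProduct_self_eq_zero.1 h0))
  set s := Real.sqrt (y ⬝ᵥ y) with hs
  have hs0 : 0 < s := Real.sqrt_pos.2 hpos
  have hss : s * s = y ⬝ᵥ y := Real.mul_self_sqrt hpos.le
  have hb : (s⁻¹ • y) ⬝ᵥ (s⁻¹ • y) = 1 := by
    rw [smul_dotProduct, dotProduct_smul, ← hss, smul_eq_mul, smul_eq_mul]
    field_simp
  have h1 := hX e _ he hb
  have h2 := hT e _ he hb
  rw [dotProduct_mulVec, dotProduct_smul, smul_eq_mul] at h1 h2
  rw [← hy, ← hss, ← mul_assoc, inv_mul_cancel₀ hs0.ne', one_mul] at h1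
  rw [dotProduct_comm]
  refine le_trans ?_ h1
  rwa [inv_mul_le_iff₀ hs0, mul_one] at h2

lemma trace_transpose_mul_le_rank {m : ℕ} (A Y : Matrix (Fin m) (Fin 3) ℝ)
    {T : Matrix (Fin 3) (Fin 3) ℝ} {c : ℝ}
    (hX : ∀ a b : Fin 3 → ℝ, a ⬝ᵥ a = 1 → b ⬝ᵥ b = 1 → a ⬝ᵥ ((Aᵀ * Y) *ᵥ b) ≤ c)
    (hT : ∀ a b : Fin 3 → ℝ, a ⬝ᵥ a = 1 → b ⬝ᵥ b = 1 → a ⬝ᵥ (T *ᵥ b) ≤ 1) :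
    ((Aᵀ * Y)ᵀ * T).trace ≤ A.rank * c := by
  obtain ⟨e, he, -, hspan⟩ := exists_orthonormal_rowSpace A
  have hXe : Aᵀ * Y = ∑ i, vecMulVec (e i) (e i ᵥ* (Aᵀ * Y)) := by
    ext k l
    have := congrFun (hspan (fun j => Y j l)) k
    rw [show (Aᵀ * Y) k l = (Aᵀ *ᵥ fun j => Y j l) k from rfl, this, Matrix.sum_apply,
      Finset.sum_apply]
    refine Finset.sum_congr rfl fun i _ => ?_
    rw [vecMulVec_apply, Pi.smul_apply, smul_eq_mul, mul_comm]
    rfl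
  have htr : ((Aᵀ * Y)ᵀ * T).trace = ∑ i, (e i ᵥ* (Aᵀ * Y)) ⬝ᵥ (e i ᵥ* T) := by
    conv_lhs => rw [hXe]
    rw [Matrix.transpose_sum, Finset.sum_mul, Matrix.trace_sum]
    refine Finset.sum_congr rfl fun i _ => ?_
    rw [trace_vecMulVec_transpose_mul, dotProduct_mulVec, dotProduct_comm]
  rw [htr]
  calc _ ≤ ∑ _i : Fin A.rank, c := Finset.sum_le_sum fun i _ =>
        vecMul_dotProduct_vecMul_le hX hT (by simp [he])
    _ = A.rank * c := by simp

lemma kronecker_mem_Ssep {a b : Fin 3 → ℝ} (ha : a ⬝ᵥ a = 1) (hb : b ⬝ᵥ b = 1) :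
    blochState a ⊗ₖ blochState b ∈ Ssep :=
  subset_convexHull ℝ _ ⟨_, _, blochState_posSemidef ha, trace_blochState a,
    blochState_posSemidef hb, trace_blochState b, rfl⟩

lemma dotProduct_mulVec_le_suppFn {m : ℕ} (A B : Matrix (Fin m) (Fin 3) ℝ)
    {Z : Matrix (Fin m) (Fin m) ℝ}
    (hbd : BddAbove ((fun C => (Zᵀ * C).trace) '' Csep A B))
    {a b : Fin 3 → ℝ} (ha : a ⬝ᵥ a = 1) (hb : b ⬝ᵥ b = 1) :
    a ⬝ᵥ ((Aᵀ * Z * B) *ᵥ b) ≤ suppFn (Csep A B) Z := by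
  refine le_csSup hbd ⟨_, ⟨_, kronecker_mem_Ssep ha hb, rfl⟩, ?_⟩
  change (Zᵀ * corr A B _).trace = _
  rw [trace_transpose_mul_corr, corrMat_blochState, trace_transpose_mul_vecMulVec]

lemma trace_le_rank_mul_suppFn {m : ℕ} (A B : Matrix (Fin m) (Fin 3) ℝ)
    {Z : Matrix (Fin m) (Fin m) ℝ}
    (hbd : BddAbove ((fun C => (Zᵀ * C).trace) '' Csep A B))
    {ρ : Matrix (Fin 2 × Fin 2) (Fin 2 × Fin 2) ℂ} (hρ : ρ ∈ Sqm) :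
    (Zᵀ * corr A B ρ).trace ≤ ((min A.rank B.rank : ℕ) : ℝ) * suppFn (Csep A B) Z := by
  rw [trace_transpose_mul_corr]
  rcases le_total A.rank B.rank with h | h
  · rw [min_eq_left h, Matrix.mul_assoc]
    refine trace_transpose_mul_le_rank A (Z * B) (fun a b ha hb => ?_)
      fun a b ha hb => dotProduct_corrMat_mulVec_le_one hρ ha hb
    rw [← Matrix.mul_assoc]
    exact dotProduct_mulVec_le_suppFn A B hbd ha hb
  · have hX : Bᵀ * (Zᵀ * A) = (Aᵀ * Z * B)ᵀ := by simp [Matrix.mul_assoc]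
    have := trace_transpose_mul_le_rank B (Zᵀ * A) (T := (corrMat ρ)ᵀ)
      (c := suppFn (Csep A B) Z) (fun a b ha hb => ?_) (fun a b ha hb => ?_)
    · rw [hX, ← Matrix.transpose_mul, Matrix.trace_transpose, Matrix.trace_mul_comm] at this
      rwa [min_eq_right h]
    · rw [hX, Matrix.mulVec_transpose, dotProduct_comm, ← dotProduct_mulVec]
      exact dotProduct_mulVec_le_suppFn A B hbd hb ha
    · rw [Matrix.mulVec_transpose, dotProduct_comm, ← dotProduct_mulVec]
      exact dotProduct_corrMat_mulVec_le_one hρ hb ha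

/-- A bound on the product states bounds all separable correlations. -/
lemma trace_le_of_mem_Csep {m : ℕ} (A B : Matrix (Fin m) (Fin 3) ℝ)
    {Z : Matrix (Fin m) (Fin m) ℝ} {c : ℝ}
    (hc : ∀ a b : Fin 3 → ℝ, a ⬝ᵥ a ≤ 1 → b ⬝ᵥ b ≤ 1 → a ⬝ᵥ ((Aᵀ * Z * B) *ᵥ b) ≤ c)
    {C : Matrix (Fin m) (Fin m) ℝ} (hC : C ∈ Csep A B) : (Zᵀ * C).trace ≤ c := by
  obtain ⟨ρ, hρ, rfl⟩ := hC
  have hconv : Convex ℝ {ρ : Matrix (Fin 2 × Fin 2) (Fin 2 × Fin 2) ℂ |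
      (Zᵀ * corr A B ρ).trace ≤ c} := by
    refine convex_halfSpace_le ⟨fun x y => ?_, fun r x => ?_⟩ c
    · rw [← Matrix.trace_add, ← Matrix.mul_add]
      congr 2
      ext i j
      simp [corr, Matrix.add_mul]
    · rw [← Matrix.trace_smul, ← Matrix.mul_smul]
      congr 2
      ext i j
      simp [corr]
  refine convexHull_min ?_ hconv hρ
  rintro _ ⟨ρA, ρB, hA, hA1, hB, hB1, rfl⟩
  obtain ⟨a, ha, rfl⟩ := exists_eq_blochState hA hA1
  obtain ⟨b, hb, rfl⟩ := exists_eq_blochState hB hB1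
  refine le_trans (le_of_eq ?_) (hc a b ha hb)
  rw [trace_transpose_mul_corr, corrMat_blochState, trace_transpose_mul_vecMulVec]

lemma exists_mem_Sqm_of_orthonormal {a b c d : Fin 3 → ℝ} (ha : a ⬝ᵥ a = 1) (hb : b ⬝ᵥ b = 1)
    (hc : c ⬝ᵥ c = 1) (hd : d ⬝ᵥ d = 1) (hac : a ⬝ᵥ c = 0) (hbd : b ⬝ᵥ d = 0) :
    ∃ ρ ∈ Sqm, (ρ * (vecObs a ⊗ₖ vecObs b)).trace = 1 ∧ (ρ * (vecObs c ⊗ₖ vecObs d)).trace = 1 ∧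
      (ρ * ((vecObs a * vecObs c) ⊗ₖ (vecObs b * vecObs d))).trace = 1 := by
  rw [Matrix.mul_kronecker_mul]
  set U := vecObs a ⊗ₖ vecObs b with hU
  set V := vecObs c ⊗ₖ vecObs d with hV
  have hU2 : U * U = 1 := vecObs_kronecker_mul_self ha hb
  have hV2 : V * V = 1 := vecObs_kronecker_mul_self hc hd
  have hUV : V * U = U * V := by
    rw [hU, hV, ← Matrix.mul_kronecker_mul, ← Matrix.mul_kronecker_mul, vecObs_anticomm hac,
      vecObs_anticomm hbd]
    ext i j
    simp [Matrix.kroneckerMap_apply]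
  have hU0 : U.trace = 0 := by rw [hU, Matrix.trace_kronecker, trace_vecObs, zero_mul]
  have hV0 : V.trace = 0 := by rw [hV, Matrix.trace_kronecker, trace_vecObs, zero_mul]
  have hUV0 : (U * V).trace = 0 := by
    rw [hU, hV, ← Matrix.mul_kronecker_mul, Matrix.trace_kronecker, trace_vecObs_mul, hac]
    simp
  set P := (1 / 2 : ℂ) • (1 + U) with hP
  set Q := (1 / 2 : ℂ) • (1 + V) with hQ
  have hPU : P * U = P := by
    rw [hP, Matrix.smul_mul, Matrix.add_mul, hU2, Matrix.one_mul, add_comm]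
  have hQV : Q * V = Q := by
    rw [hQ, Matrix.smul_mul, Matrix.add_mul, hV2, Matrix.one_mul, add_comm]
  have hQU : Q * U = U * Q := by
    simp [hQ, Matrix.add_mul, Matrix.mul_add, hUV]
  have hQP : Q * P = P * Q := by
    simp only [hP, Matrix.mul_smul, Matrix.smul_mul, Matrix.mul_add, hQU, Matrix.add_mul,
      Matrix.mul_one, Matrix.one_mul]
  have hP2 : P * P = P := half_one_add_mul_self hU2
  have hQ2 : Q * Q = Q := half_one_add_mul_self hV2
  have hPh : P.IsHermitian := half_one_add_isHermitian (vecObs_kronecker_isHermitian a b)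
  have hQh : Q.IsHermitian := half_one_add_isHermitian (vecObs_kronecker_isHermitian c d)
  have htr : (P * Q).trace = 1 := by
    rw [hP, hQ, Matrix.smul_mul, Matrix.mul_smul, Matrix.add_mul, Matrix.mul_add, Matrix.mul_add]
    simp only [Matrix.one_mul, Matrix.mul_one, Matrix.trace_smul, Matrix.trace_add, hU0, hV0, hUV0]
    simp
    norm_num
  have hρU : P * Q * U = P * Q := by
    rw [Matrix.mul_assoc, hQU, ← Matrix.mul_assoc, hPU]
  have hρV : P * Q * V = P * Q := by rw [Matrix.mul_assoc, hQV]
  refine ⟨P * Q, ⟨posSemidef_of_isHermitian_of_mul_self ?_ ?_, htr⟩, ?_, ?_, ?_⟩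
  · rw [Matrix.IsHermitian, Matrix.conjTranspose_mul, hPh.eq, hQh.eq, hQP]
  · rw [Matrix.mul_assoc, ← Matrix.mul_assoc Q, hQP, Matrix.mul_assoc P Q Q, hQ2,
      ← Matrix.mul_assoc, hP2]
  · rw [hρU, htr]
  · rw [hρV, htr]
  · rw [← Matrix.mul_assoc, hρU, hρV, htr]

lemma suppFn_ratio_eq {m : ℕ} (A B : Matrix (Fin m) (Fin 3) ℝ) {Z : Matrix (Fin m) (Fin m) ℝ}
    {K : ℝ} (hK : 0 < K) (hr : ((min A.rank B.rank : ℕ) : ℝ) ≤ K)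
    (hX : ∀ a b : Fin 3 → ℝ, a ⬝ᵥ a ≤ 1 → b ⬝ᵥ b ≤ 1 → a ⬝ᵥ ((Aᵀ * Z * B) *ᵥ b) ≤ 1)
    {ρ : Matrix (Fin 2 × Fin 2) (Fin 2 × Fin 2) ℂ} (hρ : ρ ∈ Sqm)
    (hv : ((Aᵀ * Z * B)ᵀ * corrMat ρ).trace = K) :
    Z ≠ 0 ∧ 0 < suppFn (Csep A B) Z ∧ suppFn (Cqm A B) Z / suppFn (Csep A B) Z = K := by
  have hle : ∀ x ∈ (fun C => (Zᵀ * C).trace) '' Csep A B, x ≤ 1 := by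
    rintro _ ⟨C, hC, rfl⟩
    exact trace_le_of_mem_Csep A B hX hC
  have hbd : BddAbove ((fun C => (Zᵀ * C).trace) '' Csep A B) := ⟨1, hle⟩
  rw [← trace_transpose_mul_corr] at hv
  have h1 : suppFn (Csep A B) Z ≤ 1 := Real.sSup_le hle zero_le_one
  have h2 := trace_le_rank_mul_suppFn A B hbd hρ
  rw [hv] at h2
  have hpos : 0 < suppFn (Csep A B) Z := by
    by_contra hn
    have := mul_nonpos_of_nonneg_of_nonpos
      (Nat.cast_nonneg (α := ℝ) (min A.rank B.rank)) (not_lt.1 hn)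
    linarith
  have hqm : ∀ x ∈ (fun C => (Zᵀ * C).trace) '' Cqm A B, x ≤ K * suppFn (Csep A B) Z := by
    rintro _ ⟨_, ⟨τ, hτ, rfl⟩, rfl⟩
    exact (trace_le_rank_mul_suppFn A B hbd hτ).trans (mul_le_mul_of_nonneg_right hr hpos.le)
  have h3 : K ≤ suppFn (Cqm A B) Z := le_csSup ⟨_, hqm⟩ ⟨_, ⟨ρ, hρ, rfl⟩, hv⟩
  have h4 : suppFn (Cqm A B) Z ≤ K * suppFn (Csep A B) Z :=
    csSup_le ⟨_, _, ⟨ρ, hρ, rfl⟩, hv⟩ hqm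
  refine ⟨?_, hpos, ?_⟩
  · rintro rfl
    simp at hv
    exact hK.ne hv
  · rw [div_eq_iff hpos.ne']
    exact le_antisymm h4 (le_trans (mul_le_of_le_one_right hK.le h1) h3)

lemma suppFn_ratio_le {m : ℕ} (A B : Matrix (Fin m) (Fin 3) ℝ) {Z : Matrix (Fin m) (Fin m) ℝ}
    (hZ : 0 < suppFn (Csep A B) Z) :
    suppFn (Cqm A B) Z / suppFn (Csep A B) Z ≤ ((min A.rank B.rank : ℕ) : ℝ) := by
  have hbd : BddAbove ((fun C => (Zᵀ * C).trace) '' Csep A B) := by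
    by_contra hn
    rw [suppFn, Real.sSup_of_not_bddAbove hn] at hZ
    exact lt_irrefl _ hZ
  rw [div_le_iff₀ hZ]
  refine Real.sSup_le ?_ (mul_nonneg (Nat.cast_nonneg _) hZ.le)
  rintro _ ⟨_, ⟨ρ, hρ, rfl⟩, rfl⟩
  exact trace_le_rank_mul_suppFn A B hbd hρ

lemma dotProduct_sq_le {a e : Fin 3 → ℝ} (ha : a ⬝ᵥ a ≤ 1) (he : e ⬝ᵥ e = 1) :
    (a ⬝ᵥ e) ^ 2 ≤ 1 := by
  have := dotProduct_self_star_nonneg (a - (a ⬝ᵥ e) • e)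
  simp only [star_trivial, sub_dotProduct, dotProduct_sub, smul_dotProduct, dotProduct_smul,
    smul_eq_mul, he, dotProduct_comm e a] at this
  linarith

lemma dotProduct_sq_add_sq_le {a e f : Fin 3 → ℝ} (ha : a ⬝ᵥ a ≤ 1) (he : e ⬝ᵥ e = 1)
    (hf : f ⬝ᵥ f = 1) (hef : e ⬝ᵥ f = 0) : (a ⬝ᵥ e) ^ 2 + (a ⬝ᵥ f) ^ 2 ≤ 1 := by
  have := dotProduct_self_star_nonneg (a - (a ⬝ᵥ e) • e - (a ⬝ᵥ f) • f)
  simp only [star_trivial, sub_dotProduct, dotProduct_sub, smul_dotProduct, dotProduct_smul,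
    smul_eq_mul, he, hf, hef, dotProduct_comm e a, dotProduct_comm f a, dotProduct_comm f e] at this
  linarith

lemma dotProduct_vecMulVec_mulVec (a b e f : Fin 3 → ℝ) :
    a ⬝ᵥ (vecMulVec e f *ᵥ b) = (a ⬝ᵥ e) * (b ⬝ᵥ f) := by
  simp [vecMulVec_apply, dotProduct, mulVec, Fin.sum_univ_three]
  ring

lemma transpose_mul_vecMulVec_mul {m : ℕ} (A B : Matrix (Fin m) (Fin 3) ℝ) (u v : Fin m → ℝ) :
    Aᵀ * vecMulVec u v * B = vecMulVec (Aᵀ *ᵥ u) (Bᵀ *ᵥ v) := by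
  rw [Matrix.mul_vecMulVec, Matrix.vecMulVec_mul, Matrix.mulVec_transpose B]

lemma exists_transpose_mul_eq_one {m : ℕ} {A : Matrix (Fin m) (Fin 3) ℝ} (h : A.rank = 3) :
    ∃ U : Matrix (Fin m) (Fin 3) ℝ, Aᵀ * U = 1 := by
  have htop : LinearMap.range Aᵀ.mulVecLin = ⊤ := by
    refine Submodule.eq_top_of_finrank_eq ?_
    rw [Module.finrank_fin_fun]
    exact (Matrix.rank_transpose A).trans h
  choose u hu using LinearMap.range_eq_top.1 htop
  refine ⟨Matrix.of fun i k => u (Pi.single k 1) i, ?_⟩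
  ext k l
  have := congrFun (hu (Pi.single l 1)) k
  rw [show (Aᵀ * Matrix.of fun i k => u (Pi.single k 1) i) k l =
    (Aᵀ.mulVecLin (u (Pi.single l 1))) k from rfl, this, Matrix.one_apply, Pi.single_apply]

/-- The singlet state. -/
lemma exists_singlet_state : ∃ ρ ∈ Sqm, ∑ k, corrMat ρ k k = -3 := by
  obtain ⟨ρ, hρ, h0, h1, h2⟩ := exists_mem_Sqm_of_orthonormal
    (a := Pi.single 0 1) (b := -Pi.single 0 1) (c := Pi.single 1 1) (d := -Pi.single 1 1)
    (by simp) (by simp) (by simp) (by simp) (by simp) (by simp)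
  have h3 : (vecObs (Pi.single 0 1) * vecObs (Pi.single 1 1)) ⊗ₖ
      (vecObs (-Pi.single 0 1) * vecObs (-Pi.single 1 1)) =
      vecObs (Pi.single 2 1) ⊗ₖ vecObs (-Pi.single 2 1) := by
    have hs : vecObs (Pi.single 0 1) * vecObs (Pi.single 1 1) =
        Complex.I • vecObs (Pi.single 2 1) := by
      simp only [vecObs_eq]
      ext i j
      fin_cases i <;> fin_cases j <;> simp [Matrix.mul_apply]
    have hn : ∀ a, vecObs (-a) = -vecObs a := fun a => by simp [vecObs]
    rw [hn, hn, hn, neg_mul_neg, hs, Matrix.smul_kronecker, Matrix.kronecker_smul, smul_smul,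
      Complex.I_mul_I]
    ext i j
    simp [Matrix.kroneckerMap_apply]
  rw [h3] at h2
  refine ⟨ρ, hρ, ?_⟩
  have hk : ∀ k : Fin 3,
      (ρ * (vecObs (Pi.single k 1) ⊗ₖ vecObs (-Pi.single k 1))).trace = 1 →
      corrMat ρ k k = -1 := by
    intro k h
    have := dotProduct_corrMat_mulVec ρ (Pi.single k 1) (-Pi.single k 1)
    rw [h, Matrix.mulVec_neg, Matrix.mulVec_single_one, dotProduct_neg, single_one_dotProduct]
      at this
    simp at this
    linarith
  rw [Fin.sum_univ_three, hk 0 h0, hk 1 h1, hk 2 h2]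
  norm_num

lemma exists_suppFn_ratio_of_rank_eq_three {m : ℕ} {A B : Matrix (Fin m) (Fin 3) ℝ}
    (hr : min A.rank B.rank = 3) :
    ∃ Z : Matrix (Fin m) (Fin m) ℝ, Z ≠ 0 ∧ 0 < suppFn (Csep A B) Z ∧
      suppFn (Cqm A B) Z / suppFn (Csep A B) Z = 3 := by
  have hA : A.rank ≤ 3 := A.rank_le_width
  have hB : B.rank ≤ 3 := B.rank_le_width
  obtain ⟨U, hU⟩ := exists_transpose_mul_eq_one (A := A) (by omega)
  obtain ⟨V, hV⟩ := exists_transpose_mul_eq_one (A := B) (by omega)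
  have hX : Aᵀ * (-(U * Vᵀ)) * B = -1 := by
    have : Vᵀ * B = 1 := by rw [← Matrix.transpose_one, ← hV]; simp
    rw [Matrix.mul_neg, ← Matrix.mul_assoc, hU, Matrix.one_mul, Matrix.neg_mul, this]
  obtain ⟨ρ, hρ, hT⟩ := exists_singlet_state
  refine ⟨-(U * Vᵀ), suppFn_ratio_eq A B (by norm_num) (by rw [hr]; norm_num) ?_ hρ ?_⟩
  · intro a b ha hb
    have := dotProduct_self_star_nonneg (a + b)
    simp only [star_trivial, add_dotProduct, dotProduct_add, dotProduct_comm b a] at this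
    rw [hX, Matrix.neg_mulVec, Matrix.one_mulVec, dotProduct_neg]
    linarith
  · rw [hX, Matrix.transpose_neg, Matrix.transpose_one, Matrix.neg_mul, Matrix.one_mul,
      Matrix.trace_neg, Matrix.trace]
    simp only [Matrix.diag_apply, hT, neg_neg]

lemma exists_suppFn_ratio_of_rank_eq_two {m : ℕ} {A B : Matrix (Fin m) (Fin 3) ℝ}
    (hr : min A.rank B.rank = 2) :
    ∃ Z : Matrix (Fin m) (Fin m) ℝ, Z ≠ 0 ∧ 0 < suppFn (Csep A B) Z ∧
      suppFn (Cqm A B) Z / suppFn (Csep A B) Z = 2 := by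
  obtain ⟨e, he, hu, -⟩ := exists_orthonormal_rowSpace A
  obtain ⟨f, hf, hv, -⟩ := exists_orthonormal_rowSpace B
  choose u hu using hu
  choose v hv using hv
  let i : Fin A.rank := ⟨0, by omega⟩
  let i' : Fin A.rank := ⟨1, by omega⟩
  let j : Fin B.rank := ⟨0, by omega⟩
  let j' : Fin B.rank := ⟨1, by omega⟩
  have hii : e i ⬝ᵥ e i' = 0 := by simp [he, i, i']
  have hjj : f j ⬝ᵥ f j' = 0 := by simp [hf, j, j']
  have he1 : ∀ k, e k ⬝ᵥ e k = 1 := by simp [he]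
  have hf1 : ∀ k, f k ⬝ᵥ f k = 1 := by simp [hf]
  obtain ⟨ρ, hρ, h1, h2, -⟩ :=
    exists_mem_Sqm_of_orthonormal (he1 i) (hf1 j) (he1 i') (hf1 j') hii hjj
  have hX : Aᵀ * (vecMulVec (u i) (v j) + vecMulVec (u i') (v j')) * B =
      vecMulVec (e i) (f j) + vecMulVec (e i') (f j') := by
    rw [Matrix.mul_add, Matrix.add_mul, transpose_mul_vecMulVec_mul, transpose_mul_vecMulVec_mul,
      hu, hu, hv, hv]
  refine ⟨vecMulVec (u i) (v j) + vecMulVec (u i') (v j'),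
    suppFn_ratio_eq A B (by norm_num) (by rw [hr]; norm_num) ?_ hρ ?_⟩
  · intro a b ha hb
    rw [hX, Matrix.add_mulVec, dotProduct_add, dotProduct_vecMulVec_mulVec,
      dotProduct_vecMulVec_mulVec]
    have h3 := dotProduct_sq_add_sq_le ha (he1 i) (he1 i') hii
    have h4 := dotProduct_sq_add_sq_le hb (hf1 j) (hf1 j') hjj
    nlinarith [sq_nonneg (a ⬝ᵥ e i - b ⬝ᵥ f j), sq_nonneg (a ⬝ᵥ e i' - b ⬝ᵥ f j')]
  · rw [hX, Matrix.transpose_add, Matrix.add_mul, Matrix.trace_add, trace_vecMulVec_transpose_mul,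
      trace_vecMulVec_transpose_mul, dotProduct_corrMat_mulVec, dotProduct_corrMat_mulVec, h1, h2]
    norm_num

lemma blochState_kronecker_mem_Sqm {a b : Fin 3 → ℝ} (ha : a ⬝ᵥ a = 1) (hb : b ⬝ᵥ b = 1) :
    blochState a ⊗ₖ blochState b ∈ Sqm :=
  ⟨(blochState_posSemidef ha).kronecker (blochState_posSemidef hb), by
    rw [Matrix.trace_kronecker, trace_blochState, trace_blochState, one_mul]⟩

lemma exists_suppFn_ratio_eq_one {m : ℕ} (hm : 1 ≤ m) {A B : Matrix (Fin m) (Fin 3) ℝ}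
    (hA : ∀ i, ∑ k, A i k ^ 2 = 1) (hB : ∀ i, ∑ k, B i k ^ 2 = 1)
    (hr : min A.rank B.rank ≤ 1) :
    ∃ Z : Matrix (Fin m) (Fin m) ℝ, Z ≠ 0 ∧ 0 < suppFn (Csep A B) Z ∧
      suppFn (Cqm A B) Z / suppFn (Csep A B) Z = 1 := by
  let i : Fin m := ⟨0, hm⟩
  have ha : A i ⬝ᵥ A i = 1 := by rw [← hA i]; simp [dotProduct, sq]
  have hb : B i ⬝ᵥ B i = 1 := by rw [← hB i]; simp [dotProduct, sq]
  let s : Fin m → ℝ := Pi.single i 1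
  have hX : Aᵀ * vecMulVec s s * B = vecMulVec (A i) (B i) := by
    rw [transpose_mul_vecMulVec_mul, Matrix.mulVec_single_one, Matrix.mulVec_single_one]
    rfl
  refine ⟨vecMulVec s s, suppFn_ratio_eq A B one_pos (by exact_mod_cast hr) ?_
    (blochState_kronecker_mem_Sqm ha hb) ?_⟩
  · intro a b ha' hb'
    rw [hX, dotProduct_vecMulVec_mulVec]
    nlinarith [dotProduct_sq_le ha' ha, dotProduct_sq_le hb' hb,
      sq_nonneg (a ⬝ᵥ A i - b ⬝ᵥ B i)]
  · rw [hX, corrMat_blochState, trace_vecMulVec_transpose_mul, dotProduct_vecMulVec_mulVec, ha, hb,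
      one_mul]

/-- The supremum of `φ_{C_qm}/φ_{C_sep}` is attained and equals
`3`, `2`, `1` according to `r = min{rank A, rank B} = 3, 2, 1`. -/
theorem stmt13 {m : ℕ} (hm : 1 ≤ m) (A B : Matrix (Fin m) (Fin 3) ℝ)
    (hA : ∀ i, ∑ k, A i k ^ 2 = 1) (hB : ∀ i, ∑ k, B i k ^ 2 = 1) :
    (∀ Z : Matrix (Fin m) (Fin m) ℝ, Z ≠ 0 → 0 < suppFn (Csep A B) Z →
      suppFn (Cqm A B) Z / suppFn (Csep A B) Z ≤
        (if min A.rank B.rank = 3 then (3 : ℝ)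
          else if min A.rank B.rank = 2 then 2 else 1)) ∧
    (∃ Z : Matrix (Fin m) (Fin m) ℝ, Z ≠ 0 ∧ 0 < suppFn (Csep A B) Z ∧
      suppFn (Cqm A B) Z / suppFn (Csep A B) Z =
        (if min A.rank B.rank = 3 then (3 : ℝ)
          else if min A.rank B.rank = 2 then 2 else 1)) := by
  have hA3 : A.rank ≤ 3 := A.rank_le_width
  refine ⟨fun Z _ hZ => (suppFn_ratio_le A B hZ).trans ?_, ?_⟩
  · split_ifs with h3 h2
    · rw [h3]; norm_num
    · rw [h2]; norm_num
    · exact_mod_cast (by omega : min A.rank B.rank ≤ 1)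
  · split_ifs with h3 h2
    · exact exists_suppFn_ratio_of_rank_eq_three h3
    · exact exists_suppFn_ratio_of_rank_eq_two h2
    · exact exists_suppFn_ratio_eq_one hm hA hB (by omega)

end BellCorr
end
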